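/- Let H be an invertible Hermitian n×n quaternion matrix and let A be an n×n quaternion matrix that is H-selfadjoint. Then there exists an invertible n×n quaternion matrix S, an integer β with 0 ≤ α ≤ β, sizes k_1,…,k_β, numbers λ_1,…,λ_α that are real, numbers λ_{α+1},…,λ_β that are complex with strictly positive imaginary part (viewed as quaternions), and signs η_1,…,η_α ∈ {1,−1}, such that S⁻¹AS = J_{k_1}(λ_1) ⊕ ⋯ ⊕ J_{k_α}(λ_α) ⊕ (J_{k_{α+1}}(λ_{α+1}) ⊕ J_{k_{α+1}}(conj λ_{α+1})) ⊕ ⋯ ⊕ (J_{k_β}(λ_β) ⊕ J_{k_β}(conj λ_β)) and S*HS = η_1 Q_{k_1} ⊕ ⋯ ⊕ η_α Q_{k_α} ⊕ Q_{2k_{α+1}} ⊕ ⋯ ⊕ Q_{2k_β}. -/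

import Mathlib

open Matrix

noncomputable section

/-- The `k×k` upper-triangular Jordan block with eigenvalue `lam`. -/
def jordanBlock {R : Type*} [Zero R] [One R] (lam : R) (k : ℕ) : Matrix (Fin k) (Fin k) R :=
  Matrix.of fun i j => if (i : ℕ) = (j : ℕ) then lam else if (i : ℕ) + 1 = (j : ℕ) then 1 else 0

/-- The `k×k` sip matrix: ones on the main anti-diagonal, zeros elsewhere. -/
def sip (R : Type*) [Zero R] [One R] (k : ℕ) : Matrix (Fin k) (Fin k) R :=
  Matrix.of fun i j => if (i : ℕ) + (j : ℕ) = k - 1 then 1 else 0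

/-- The order-preserving identification of `Fin k ⊕ Fin k` with `Fin (2*k)`. -/
def finTwoMul (k : ℕ) : (Fin k ⊕ Fin k) ≃ Fin (2 * k) :=
  finSumFinEquiv.trans (finCongr (two_mul k).symm)

/-- Block-diagonal direct sum `M ⊕ N` of two `k×k` matrices, as a `(2k)×(2k)` matrix. -/
def dsum2 {R : Type*} [Zero R] {k : ℕ} (M N : Matrix (Fin k) (Fin k) R) :
    Matrix (Fin (2 * k)) (Fin (2 * k)) R :=
  Matrix.reindex (finTwoMul k) (finTwoMul k) (Matrix.fromBlocks M 0 0 N)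

/-- The `2n×2n` complex matrix `[[A₁, conj A₂], [−A₂, conj A₁]]`. -/
def omegaMap {n : ℕ} (A₁ A₂ : Matrix (Fin n) (Fin n) ℂ) :
    Matrix (Fin (2 * n)) (Fin (2 * n)) ℂ :=
  Matrix.reindex (finTwoMul n) (finTwoMul n)
    (Matrix.fromBlocks A₁ (A₂.map (starRingEnd ℂ)) (-A₂) (A₁.map (starRingEnd ℂ)))

/-- Membership in the real subalgebra `Ω_{2n}` of `2n×2n` complex matrices. -/
def InOmega {n : ℕ} (M : Matrix (Fin (2 * n)) (Fin (2 * n)) ℂ) : Prop :=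
  ∃ A₁ A₂ : Matrix (Fin n) (Fin n) ℂ, M = omegaMap A₁ A₂

/-- The complex number `z = a + b·i` viewed as a quaternion. -/
def cq (z : ℂ) : Quaternion ℝ := ⟨z.re, z.im, 0, 0⟩

theorem pow_apply_mem_of_invariant {K V : Type*} [Semiring K] [AddCommMonoid V] [Module K V]
    {N : Module.End K V} {W : Submodule K V} (hW : ∀ v ∈ W, N v ∈ W) (i : ℕ) :
    ∀ v ∈ W, (N ^ i) v ∈ W := by
  induction i with
  | zero => simp
  | succ i ih => intro v hv; rw [pow_succ]; exact ih _ (hW v hv)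

theorem pow_selfAdjoint {K V : Type*} [CommSemiring K] [AddCommMonoid V] [Module K V]
    {N : Module.End K V} {ω : V →ₗ[K] V →ₗ[K] K} (hN : ∀ x y, ω (N x) y = ω x (N y))
    (i : ℕ) : ∀ x y, ω ((N ^ i) x) y = ω x ((N ^ i) y) := by
  induction i with
  | zero => simp
  | succ i ih =>
    intro x y
    rw [pow_succ, Module.End.mul_apply, ih, hN, ← Module.End.mul_apply, ← pow_succ', pow_succ]

/-- A self-adjoint operator for a nondegenerate bilinear form has a root vector pairing
nontrivially with the bottom of a Jordan chain of the same eigenvalue. -/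
theorem exists_root_vectors {V : Type*} [AddCommGroup V] [Module ℂ V] [FiniteDimensional ℂ V]
    [Nontrivial V] (A : Module.End ℂ V) (ω : V →ₗ[ℂ] V →ₗ[ℂ] ℂ)
    (hnd : ∀ y, (∀ x, ω x y = 0) → y = 0) (hA : ∀ x y, ω (A x) y = ω x (A y)) :
    ∃ (μ : ℂ) (m : ℕ) (x y : V),
      ((A - algebraMap ℂ (Module.End ℂ V) μ) ^ (m + 1)) x = 0 ∧
      ((A - algebraMap ℂ (Module.End ℂ V) μ) ^ (m + 1)) y = 0 ∧
      ω x (((A - algebraMap ℂ (Module.End ℂ V) μ) ^ m) y) ≠ 0 := by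
  have hint : IsIntegral ℂ A := Algebra.IsIntegral.isIntegral A
  have hne : minpoly ℂ A ≠ 0 := minpoly.ne_zero hint
  obtain ⟨μ, hμ⟩ := Complex.exists_root (minpoly.degree_pos hint)
  obtain ⟨R, hR, hnR⟩ := (minpoly ℂ A).exists_eq_pow_rootMultiplicity_mul_and_not_dvd hne μ
  obtain ⟨m, hm⟩ : ∃ m, (minpoly ℂ A).rootMultiplicity μ = m + 1 :=
    ⟨_, (Nat.succ_pred_eq_of_pos ((Polynomial.rootMultiplicity_pos hne).2 hμ)).symm⟩
  rw [hm] at hR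
  have hpoly : ∀ (p : Polynomial ℂ) (x y : V),
      ω (Polynomial.aeval A p x) y = ω x (Polynomial.aeval A p y) := by
    intro p
    induction p using Polynomial.induction_on' with
    | add p q hp hq => intro x y; simp [hp, hq]
    | monomial k c =>
      intro x y
      have hpow := pow_selfAdjoint hA
      simp [Polynomial.aeval_monomial, hpow]
  have hlin : Polynomial.aeval A (Polynomial.X - Polynomial.C μ)
      = A - algebraMap ℂ (Module.End ℂ V) μ := by simp
  have hker : ∀ z, ((A - algebraMap ℂ (Module.End ℂ V) μ) ^ (m + 1))
      (Polynomial.aeval A R z) = 0 := by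
    intro z
    rw [← hlin, ← map_pow, ← Module.End.mul_apply, ← map_mul, ← hR, minpoly.aeval]
    rfl
  have hD : Polynomial.aeval A (R * ((Polynomial.X - Polynomial.C μ) ^ m * R)) ≠ 0 := by
    intro h0
    have hdvd := minpoly.dvd ℂ A h0
    have hX : Polynomial.X - Polynomial.C μ ≠ 0 := Polynomial.X_sub_C_ne_zero μ
    have hR0 : R ≠ 0 := by rintro rfl; simp at hnR
    have : ((Polynomial.X - Polynomial.C μ) ^ m * R) * (Polynomial.X - Polynomial.C μ) ∣
        ((Polynomial.X - Polynomial.C μ) ^ m * R) * R := by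
      rw [hR] at hdvd
      convert hdvd using 1 <;> ring
    exact hnR ((mul_dvd_mul_iff_left (mul_ne_zero (pow_ne_zero _ hX) hR0)).1 this)
  obtain ⟨z', hz'⟩ : ∃ z, Polynomial.aeval A (R * ((Polynomial.X - Polynomial.C μ) ^ m * R)) z
      ≠ 0 := by
    by_contra! h
    exact hD (LinearMap.ext h)
  obtain ⟨z, hz⟩ : ∃ z, ω z (Polynomial.aeval A
      (R * ((Polynomial.X - Polynomial.C μ) ^ m * R)) z') ≠ 0 := by
    by_contra! h
    exact hz' (hnd _ h)
  refine ⟨μ, m, Polynomial.aeval A R z, Polynomial.aeval A R z', hker _, hker _, ?_⟩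
  rw [hpoly, ← hlin, ← map_pow]
  simpa only [map_mul, Module.End.mul_apply] using hz

/-- A vector of maximal height can be modified, within an invariant submodule killed by
`N ^ (m + 1)`, so that a given functional sees only the bottom of its Jordan chain. -/
theorem exists_normalized_functional {K V : Type*} [Field K] [AddCommGroup V] [Module K V]
    (N : Module.End K V) (φ : V →ₗ[K] K) (W : Submodule K V) (m : ℕ)
    (hW : ∀ v ∈ W, N v ∈ W) (hN : ∀ v ∈ W, (N ^ (m + 1)) v = 0)
    {y : V} (hy : y ∈ W) (hne : φ ((N ^ m) y) ≠ 0) {c : K} (hc : c ≠ 0) :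
    ∃ z ∈ W, φ ((N ^ m) z) = c ∧ ∀ i < m, φ ((N ^ i) z) = 0 := by
  have hWp := pow_apply_mem_of_invariant hW
  have hN' : ∀ v ∈ W, ∀ i, m < i → (N ^ i) v = 0 := fun v hv i hi =>
    Module.End.pow_map_zero_of_le hi (hN v hv)
  have key : ∀ d ≤ m, ∃ z ∈ W, φ ((N ^ m) z) = c ∧
      ∀ i, m - d ≤ i → i < m → φ ((N ^ i) z) = 0 := by
    intro d
    induction d with
    | zero =>
      intro _
      refine ⟨(c / φ ((N ^ m) y)) • y, W.smul_mem _ hy, by simp [hne], fun i h1 h2 => by omega⟩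
    | succ d ih =>
      intro hd
      obtain ⟨z, hz, hzc, hz0⟩ := ih (by omega)
      have hcomp : ∀ i, (N ^ i) (z - (φ ((N ^ (m - (d + 1))) z) / c) • (N ^ (d + 1)) z)
          = (N ^ i) z - (φ ((N ^ (m - (d + 1))) z) / c) • (N ^ (i + (d + 1))) z := by
        intro i
        rw [map_sub, map_smul, ← Module.End.mul_apply, ← pow_add]
      refine ⟨z - (φ ((N ^ (m - (d + 1))) z) / c) • (N ^ (d + 1)) z,
        W.sub_mem hz (W.smul_mem _ (hWp _ _ hz)), ?_, ?_⟩
      · rw [hcomp, hN' z hz (m + (d + 1)) (by omega)]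
        simpa using hzc
      · intro i h1 h2
        rw [hcomp]
        rcases Nat.eq_or_lt_of_le h1 with h | h
        · subst h
          rw [show m - (d + 1) + (d + 1) = m by omega]
          simp [hzc, hc]
        · rw [hN' z hz (i + (d + 1)) (by omega)]
          simpa using hz0 i (by omega) h2
  obtain ⟨z, hz, hzc, hz0⟩ := key m le_rfl
  exact ⟨z, hz, hzc, fun i hi => hz0 i (by omega) hi⟩

/-- A vector of maximal height can be modified, within an invariant submodule killed by
`N ^ (m + 1)`, so that its Jordan chain is in normal form for a symmetric bilinear form
for which `N` is self-adjoint. -/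
theorem exists_normalized_vector {V : Type*} [AddCommGroup V] [Module ℝ V]
    (N : Module.End ℝ V) (β : V →ₗ[ℝ] V →ₗ[ℝ] ℝ)
    (hA : ∀ x y, β (N x) y = β x (N y)) (W : Submodule ℝ V) (m : ℕ)
    (hW : ∀ v ∈ W, N v ∈ W) (hN : ∀ v ∈ W, (N ^ (m + 1)) v = 0)
    {v : V} (hv : v ∈ W) (hne : β v ((N ^ m) v) ≠ 0) :
    ∃ z ∈ W, (β z ((N ^ m) z) = 1 ∨ β z ((N ^ m) z) = -1) ∧
      ∀ i < m, β z ((N ^ i) z) = 0 := by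
  have hWp := pow_apply_mem_of_invariant hW
  have hN' : ∀ v ∈ W, ∀ i, m < i → (N ^ i) v = 0 := fun v hv i hi =>
    Module.End.pow_map_zero_of_le hi (hN v hv)
  have hpow := pow_selfAdjoint hA
  have key : ∀ d ≤ m, ∃ z ∈ W, (β z ((N ^ m) z) = 1 ∨ β z ((N ^ m) z) = -1) ∧
      ∀ i, m - d ≤ i → i < m → β z ((N ^ i) z) = 0 := by
    intro d
    induction d with
    | zero =>
      intro _
      set r := β v ((N ^ m) v) with hr
      refine ⟨(Real.sqrt |r|)⁻¹ • v, W.smul_mem _ hv, ?_, fun i h1 h2 => by omega⟩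
      have h1 : β ((Real.sqrt |r|)⁻¹ • v) ((N ^ m) ((Real.sqrt |r|)⁻¹ • v)) = r / |r| := by
        simp only [map_smul, LinearMap.smul_apply, smul_eq_mul, ← hr]
        rw [← mul_assoc, ← mul_inv, Real.mul_self_sqrt (abs_nonneg _)]
        ring
      rw [h1]
      rcases lt_or_gt_of_ne hne with h | h
      · right; rw [abs_of_neg h, div_neg, div_self hne]
      · left; rw [abs_of_pos h, div_self hne]
    | succ d ih =>
      intro hd
      obtain ⟨z, hz, hzc, hz0⟩ := ih (by omega)
      obtain ⟨c, hc⟩ : ∃ c, c = β z ((N ^ m) z) := ⟨_, rfl⟩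
      have hc0 : c ≠ 0 := by rcases hzc with h | h <;> rw [hc, h] <;> norm_num
      obtain ⟨a, ha⟩ : ∃ a, a = β z ((N ^ (m - (d + 1))) z) / (2 * c) := ⟨_, rfl⟩
      have hcomp : ∀ i, β (z - a • (N ^ (d + 1)) z) ((N ^ i) (z - a • (N ^ (d + 1)) z))
          = β z ((N ^ i) z) - 2 * a * β z ((N ^ (i + (d + 1))) z)
            + a ^ 2 * β z ((N ^ (i + (d + 1) + (d + 1))) z) := by
        intro i
        simp only [map_sub, map_smul, LinearMap.sub_apply, LinearMap.smul_apply, smul_eq_mul,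
          hpow, ← Module.End.mul_apply, ← pow_add]
        rw [show d + 1 + i = i + (d + 1) by ring,
          show d + 1 + (i + (d + 1)) = i + (d + 1) + (d + 1) by ring]
        ring
      refine ⟨z - a • (N ^ (d + 1)) z, W.sub_mem hz (W.smul_mem _ (hWp _ _ hz)), ?_, ?_⟩
      · rw [hcomp, hN' z hz (m + (d + 1)) (by omega),
          hN' z hz (m + (d + 1) + (d + 1)) (by omega)]
        simpa using hzc
      · intro i h1 h2
        rw [hcomp, hN' z hz (i + (d + 1) + (d + 1)) (by omega)]
        rcases Nat.eq_or_lt_of_le h1 with h | h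
        · subst h
          rw [show m - (d + 1) + (d + 1) = m by omega, ← hc, ha]
          simp only [map_zero]
          field_simp
          ring
        · rw [hN' z hz (i + (d + 1)) (by omega), hz0 i (by omega) h2]
          simp
  obtain ⟨z, hz, hzc, hz0⟩ := key m le_rfl
  exact ⟨z, hz, hzc, fun i hi => hz0 i (by omega) hi⟩

section RightModule

/-- The quaternion unit `j`. -/
def quatJ : Quaternion ℝ := ⟨0, 0, 1, 0⟩

/-- The complex number `a` in the decomposition `q = a + j b`. -/
def complexPart (q : Quaternion ℝ) : ℂ := ⟨q.re, q.imI⟩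

/-- The complex number `b` in the decomposition `q = a + j b`. -/
def jPart (q : Quaternion ℝ) : ℂ := ⟨q.imJ, -q.imK⟩

@[simp] theorem cq_re (z : ℂ) : (cq z).re = z.re := rfl
@[simp] theorem cq_imI (z : ℂ) : (cq z).imI = z.im := rfl
@[simp] theorem cq_imJ (z : ℂ) : (cq z).imJ = 0 := rfl
@[simp] theorem cq_imK (z : ℂ) : (cq z).imK = 0 := rfl
@[simp] theorem quatJ_re : quatJ.re = 0 := rfl
@[simp] theorem quatJ_imI : quatJ.imI = 0 := rfl
@[simp] theorem quatJ_imJ : quatJ.imJ = 1 := rfl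
@[simp] theorem quatJ_imK : quatJ.imK = 0 := rfl

theorem cq_zero : cq 0 = 0 := rfl
theorem cq_one : cq 1 = 1 := rfl
theorem cq_add (z w : ℂ) : cq (z + w) = cq z + cq w := by ext <;> simp
theorem cq_mul (z w : ℂ) : cq (z * w) = cq z * cq w := by ext <;> simp
theorem cq_ofReal (r : ℝ) : cq r = algebraMap ℝ (Quaternion ℝ) r := by
  ext <;> simp [Quaternion.algebraMap_def]
theorem star_cq (z : ℂ) : star (cq z) = cq (starRingEnd ℂ z) := by ext <;> simp
theorem quatJ_mul_self : quatJ * quatJ = -1 := by ext <;> simp <;> rfl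
theorem cq_mul_quatJ (z : ℂ) : cq z * quatJ = quatJ * cq (starRingEnd ℂ z) := by
  ext <;> simp

theorem complexPart_sub (p q : Quaternion ℝ) :
    complexPart (p - q) = complexPart p - complexPart q := by
  apply Complex.ext <;> simp [complexPart]
theorem complexPart_zero : complexPart 0 = 0 := rfl
theorem complexPart_mul_cq (q : Quaternion ℝ) (z : ℂ) :
    complexPart (q * cq z) = complexPart q * z := by
  apply Complex.ext <;> simp [complexPart]
theorem complexPart_cq_mul (q : Quaternion ℝ) (z : ℂ) :
    complexPart (cq z * q) = z * complexPart q := by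
  apply Complex.ext <;> simp [complexPart]

theorem jPart_add (p q : Quaternion ℝ) : jPart (p + q) = jPart p + jPart q := by
  apply Complex.ext <;> simp [jPart]; ring
theorem jPart_zero : jPart 0 = 0 := by apply Complex.ext <;> simp [jPart] <;> rfl
theorem jPart_mul_cq (q : Quaternion ℝ) (z : ℂ) : jPart (q * cq z) = jPart q * z := by
  apply Complex.ext
  · simp [jPart]
  · simp [jPart]; ring
theorem jPart_cq_mul (q : Quaternion ℝ) (z : ℂ) :
    jPart (cq z * q) = starRingEnd ℂ z * jPart q := by
  apply Complex.ext
  · simp [jPart]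
  · simp [jPart]; ring
theorem jPart_star (q : Quaternion ℝ) : jPart (star q) = -jPart q := by
  apply Complex.ext <;> simp [jPart]
theorem jPart_conj_quatJ (q : Quaternion ℝ) :
    jPart (star quatJ * q * quatJ) = starRingEnd ℂ (jPart q) := by
  apply Complex.ext <;> simp [jPart]
theorem eq_quatJ_mul_jPart {q : Quaternion ℝ} (h : complexPart q = 0) :
    q = quatJ * cq (jPart q) := by
  have h1 : q.re = 0 := congrArg Complex.re h
  have h2 : q.imI = 0 := congrArg Complex.im h
  ext <;> simp [jPart, h1, h2]
theorem eq_zero_of_parts {q : Quaternion ℝ} (h : complexPart q = 0) (h' : jPart q = 0) :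
    q = 0 := by
  rw [eq_quatJ_mul_jPart h, h', cq_zero, mul_zero]

/-- Complex scalars act on quaternions by multiplication on the right. -/
@[reducible] def rightComplexModule : Module ℂ (Quaternion ℝ) where
  smul z q := q * cq z
  one_smul q := by change q * cq 1 = q; rw [cq_one, mul_one]
  mul_smul z w q := by
    change q * cq (z * w) = q * cq w * cq z
    rw [mul_comm z w, cq_mul, mul_assoc]
  smul_zero z := zero_mul (cq z)
  zero_smul q := by change q * cq 0 = 0; rw [cq_zero, mul_zero]
  add_smul z w q := by change q * cq (z + w) = q * cq z + q * cq w; rw [cq_add, mul_add]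
  smul_add z p q := add_mul p q (cq z)

attribute [local instance] rightComplexModule

theorem right_smul_def (z : ℂ) (q : Quaternion ℝ) : z • q = q * cq z := rfl

instance rightScalarTower : IsScalarTower ℝ ℂ (Quaternion ℝ) where
  smul_assoc r z q := by
    rw [right_smul_def, right_smul_def]
    ext <;> simp <;> ring

instance rightModuleFinite : Module.Finite ℂ (Quaternion ℝ) :=
  Module.Finite.of_restrictScalars_finite ℝ ℂ (Quaternion ℝ)

variable {ι κ : Type*}

/-- Multiplication of a quaternion column vector by a quaternion on the right. -/
def rmul (v : ι → Quaternion ℝ) (q : Quaternion ℝ) : ι → Quaternion ℝ := fun i => v i * q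

theorem smul_eq_rmul (z : ℂ) (v : ι → Quaternion ℝ) : z • v = rmul v (cq z) := rfl

theorem rmul_zero_left (q : Quaternion ℝ) : rmul (0 : ι → Quaternion ℝ) q = 0 := by
  ext1 i; simp [rmul]

variable [Fintype ι]

/-- Multiplication of column vectors by a quaternion matrix, as a map linear for the right
action of the complex numbers. -/
def mulVecC (M : Matrix κ ι (Quaternion ℝ)) :
    (ι → Quaternion ℝ) →ₗ[ℂ] (κ → Quaternion ℝ) where
  toFun v := M *ᵥ v
  map_add' := M.mulVec_add
  map_smul' z v := by
    ext1 i
    simp only [mulVec, dotProduct, Pi.smul_apply, right_smul_def, Finset.sum_mul, mul_assoc,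
      RingHom.id_apply]

@[simp] theorem mulVecC_apply (M : Matrix κ ι (Quaternion ℝ)) (v : ι → Quaternion ℝ) :
    mulVecC M v = M *ᵥ v := rfl

/-- Multiplication of column vectors by a quaternion matrix, as a real linear map. -/
def mulVecR (M : Matrix κ ι (Quaternion ℝ)) :
    (ι → Quaternion ℝ) →ₗ[ℝ] (κ → Quaternion ℝ) where
  toFun v := M *ᵥ v
  map_add' := M.mulVec_add
  map_smul' r v := M.mulVec_smul r v

@[simp] theorem mulVecR_apply (M : Matrix κ ι (Quaternion ℝ)) (v : ι → Quaternion ℝ) :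
    mulVecR M v = M *ᵥ v := rfl

theorem mulVec_rmul (M : Matrix κ ι (Quaternion ℝ)) (v : ι → Quaternion ℝ) (q : Quaternion ℝ) :
    M *ᵥ rmul v q = fun i => (M *ᵥ v) i * q := by
  ext1 i
  simp only [mulVec, dotProduct, rmul, Finset.sum_mul, mul_assoc]

/-- The sesquilinear form `(x, y) ↦ x* H y`. -/
def sesq (H : Matrix ι ι (Quaternion ℝ)) (x y : ι → Quaternion ℝ) : Quaternion ℝ :=
  star x ⬝ᵥ (H *ᵥ y)

variable {H A : Matrix ι ι (Quaternion ℝ)}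

theorem sesq_add_left (x x' y : ι → Quaternion ℝ) :
    sesq H (x + x') y = sesq H x y + sesq H x' y := by
  simp [sesq, add_dotProduct]

theorem sesq_add_right (x y y' : ι → Quaternion ℝ) :
    sesq H x (y + y') = sesq H x y + sesq H x y' := by
  simp [sesq, mulVec_add, dotProduct_add]

theorem sesq_sub_left (x x' y : ι → Quaternion ℝ) :
    sesq H (x - x') y = sesq H x y - sesq H x' y := by
  simp [sesq, sub_dotProduct]

theorem sesq_sub_right (x y y' : ι → Quaternion ℝ) :
    sesq H x (y - y') = sesq H x y - sesq H x y' := by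
  simp [sesq, mulVec_sub, dotProduct_sub]

theorem sesq_zero_left (y : ι → Quaternion ℝ) : sesq H 0 y = 0 := by simp [sesq]

theorem sesq_zero_right (x : ι → Quaternion ℝ) : sesq H x 0 = 0 := by simp [sesq]

theorem sesq_rmul_left (x y : ι → Quaternion ℝ) (q : Quaternion ℝ) :
    sesq H (rmul x q) y = star q * sesq H x y := by
  simp only [sesq, rmul, dotProduct, Pi.star_apply, star_mul, Finset.mul_sum, mul_assoc]

theorem sesq_rmul_right (x y : ι → Quaternion ℝ) (q : Quaternion ℝ) :
    sesq H x (rmul y q) = sesq H x y * q := by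
  simp only [sesq, mulVec_rmul, dotProduct, Finset.sum_mul, mul_assoc]

theorem sesq_real_smul_left (r : ℝ) (x y : ι → Quaternion ℝ) :
    sesq H (r • x) y = r • sesq H x y := by
  simp only [sesq, dotProduct, Pi.star_apply, Pi.smul_apply, Quaternion.star_smul,
    smul_mul_assoc, Finset.smul_sum]

theorem sesq_real_smul_right (r : ℝ) (x y : ι → Quaternion ℝ) :
    sesq H x (r • y) = r • sesq H x y := by
  simp [sesq, mulVec_smul, dotProduct_smul]

theorem star_sesq (hH : H.IsHermitian) (x y : ι → Quaternion ℝ) :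
    star (sesq H x y) = sesq H y x := by
  rw [sesq, sesq, star_dotProduct (y), star_mulVec, hH.eq, ← dotProduct_mulVec]

theorem sesq_mulVec_left (hA : H * A = Aᴴ * H) (x y : ι → Quaternion ℝ) :
    sesq H (A *ᵥ x) y = sesq H x (A *ᵥ y) := by
  rw [sesq, sesq, star_mulVec, ← dotProduct_mulVec, mulVec_mulVec, mulVec_mulVec, hA]

variable (H) in
/-- The complex bilinear form given by the `j`-part of `x* H y`. -/
def jForm : (ι → Quaternion ℝ) →ₗ[ℂ] (ι → Quaternion ℝ) →ₗ[ℂ] ℂ :=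
  LinearMap.mk₂ ℂ (fun x y => jPart (sesq H x y))
    (fun x x' y => by rw [sesq_add_left, jPart_add])
    (fun z x y => by
      rw [smul_eq_rmul, sesq_rmul_left, star_cq, jPart_cq_mul, Complex.conj_conj, smul_eq_mul])
    (fun x y y' => by rw [sesq_add_right, jPart_add])
    (fun z x y => by
      rw [smul_eq_rmul, sesq_rmul_right, jPart_mul_cq, smul_eq_mul, mul_comm])

theorem jForm_apply (x y : ι → Quaternion ℝ) : jForm H x y = jPart (sesq H x y) := rfl

variable (H) in
/-- The real bilinear form given by the real part of `x* H y`. -/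
def reForm : (ι → Quaternion ℝ) →ₗ[ℝ] (ι → Quaternion ℝ) →ₗ[ℝ] ℝ :=
  LinearMap.mk₂ ℝ (fun x y => (sesq H x y).re)
    (fun x x' y => by rw [sesq_add_left, Quaternion.re_add])
    (fun r x y => by rw [sesq_real_smul_left, Quaternion.re_smul])
    (fun x y y' => by rw [sesq_add_right, Quaternion.re_add])
    (fun r x y => by rw [sesq_real_smul_right, Quaternion.re_smul])

theorem reForm_apply (x y : ι → Quaternion ℝ) : reForm H x y = (sesq H x y).re := rfl

theorem jForm_antisymm (hH : H.IsHermitian) (x y : ι → Quaternion ℝ) :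
    jForm H x y = -jForm H y x := by
  rw [jForm_apply, jForm_apply, ← star_sesq hH, jPart_star]

variable (A) in
/-- The operator `v ↦ A v - v μ`. -/
def shift (μ : ℂ) : Module.End ℂ (ι → Quaternion ℝ) :=
  mulVecC A - algebraMap ℂ (Module.End ℂ (ι → Quaternion ℝ)) μ

theorem shift_apply (μ : ℂ) (v : ι → Quaternion ℝ) :
    shift A μ v = A *ᵥ v - rmul v (cq μ) := rfl

theorem mulVec_eq_rmul_add_shift (μ : ℂ) (v : ι → Quaternion ℝ) :
    A *ᵥ v = rmul v (cq μ) + shift A μ v := by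
  rw [shift_apply]; abel

theorem mulVecC_selfAdjoint (hA : H * A = Aᴴ * H) (x y : ι → Quaternion ℝ) :
    jForm H (mulVecC A x) y = jForm H x (mulVecC A y) := by
  rw [jForm_apply, jForm_apply, mulVecC_apply, mulVecC_apply, sesq_mulVec_left hA]

theorem shift_selfAdjoint (hA : H * A = Aᴴ * H) (μ : ℂ) (x y : ι → Quaternion ℝ) :
    jForm H (shift A μ x) y = jForm H x (shift A μ y) := by
  simp only [shift, LinearMap.sub_apply, Module.algebraMap_end_apply, map_sub, map_smul,
    LinearMap.smul_apply, mulVecC_selfAdjoint hA]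

theorem shift_rmul_quatJ (μ : ℂ) (v : ι → Quaternion ℝ) :
    shift A (starRingEnd ℂ μ) (rmul v quatJ) = rmul (shift A μ v) quatJ := by
  rw [shift_apply, shift_apply, mulVec_rmul]
  ext1 i
  simp only [Pi.sub_apply, rmul, sub_mul, mul_assoc, cq_mul_quatJ]

theorem shift_pow_rmul_quatJ (μ : ℂ) (k : ℕ) (v : ι → Quaternion ℝ) :
    (shift A (starRingEnd ℂ μ) ^ k) (rmul v quatJ) = rmul ((shift A μ ^ k) v) quatJ := by
  induction k generalizing v with
  | zero => simp
  | succ k ih => rw [pow_succ, Module.End.mul_apply, shift_rmul_quatJ, ih, pow_succ,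
      Module.End.mul_apply]

theorem mulVec_rmul_eq_zero {C : Matrix κ ι (Quaternion ℝ)} {v : ι → Quaternion ℝ}
    (h : C *ᵥ v = 0) (q : Quaternion ℝ) : C *ᵥ rmul v q = 0 := by
  rw [mulVec_rmul, h]; ext1 i; simp

theorem mulVec_shift_eq_zero [Fintype κ] {C : Matrix κ ι (Quaternion ℝ)}
    {D : Matrix κ κ (Quaternion ℝ)} (hC : C * A = D * C) (μ : ℂ) {v : ι → Quaternion ℝ}
    (h : C *ᵥ v = 0) : C *ᵥ shift A μ v = 0 := by
  rw [shift_apply, mulVec_sub, mulVec_mulVec, hC, ← mulVec_mulVec, h, mulVec_zero,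
    mulVec_rmul_eq_zero h, sub_zero]

theorem exists_root_vectors_ker [Fintype κ] (hA : H * A = Aᴴ * H)
    {C : Matrix κ ι (Quaternion ℝ)} {D : Matrix κ κ (Quaternion ℝ)} (hC : C * A = D * C)
    (hnd : ∀ y, C *ᵥ y = 0 → (∀ x, C *ᵥ x = 0 → sesq H x y = 0) → y = 0)
    (hex : ∃ y, C *ᵥ y = 0 ∧ y ≠ 0) :
    ∃ (μ : ℂ) (m : ℕ) (x y : ι → Quaternion ℝ), 0 ≤ μ.im ∧ C *ᵥ x = 0 ∧ C *ᵥ y = 0 ∧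
      (shift A μ ^ (m + 1)) x = 0 ∧ (shift A μ ^ (m + 1)) y = 0 ∧
      jForm H x ((shift A μ ^ m) y) ≠ 0 := by
  let W : Submodule ℂ (ι → Quaternion ℝ) := LinearMap.ker (mulVecC C)
  have hmem : ∀ v, v ∈ W ↔ C *ᵥ v = 0 := fun v => LinearMap.mem_ker
  have hAW : ∀ v ∈ W, mulVecC A v ∈ W := by
    intro v hv
    rw [hmem] at hv ⊢
    rw [mulVecC_apply, mulVec_mulVec, hC, ← mulVec_mulVec, hv, mulVec_zero]
  have : Nontrivial W := by
    obtain ⟨y, hy, hy0⟩ := hex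
    exact ⟨⟨y, (hmem y).2 hy⟩, 0, fun h => hy0 (congrArg Subtype.val h)⟩
  obtain ⟨μ, m, x, y, hx, hy, hxy⟩ := exists_root_vectors ((mulVecC A).restrict hAW)
    ((jForm H).domRestrict₁₂ W W) (by
      rintro ⟨y, hy⟩ h
      refine Subtype.ext (hnd y ((hmem y).1 hy) fun x hx => eq_zero_of_parts ?_ ?_)
      · have h1 : jForm H (rmul x quatJ) y = 0 :=
          h ⟨rmul x quatJ, (hmem _).2 (mulVec_rmul_eq_zero hx _)⟩
        rw [jForm_apply, sesq_rmul_left] at h1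
        have h2 : jForm H x y = 0 := h ⟨x, (hmem x).2 hx⟩
        rw [jForm_apply] at h2
        have h3 := congrArg Complex.re h1
        have h4 := congrArg Complex.im h1
        apply Complex.ext
        · simpa [jPart, complexPart] using h3
        · simpa [jPart, complexPart] using h4
      · exact h ⟨x, (hmem x).2 hx⟩)
    (fun x y => mulVecC_selfAdjoint hA _ _)
  have hpow : ∀ (k : ℕ) (v : W), ((((mulVecC A).restrict hAW
      - algebraMap ℂ (Module.End ℂ W) μ) ^ k) v : ι → Quaternion ℝ) = (shift A μ ^ k) v := by
    intro k
    induction k with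
    | zero => simp
    | succ k ih =>
      intro v
      rw [pow_succ, Module.End.mul_apply, ih, pow_succ, Module.End.mul_apply]
      rfl
  have hx' : (shift A μ ^ (m + 1)) x = 0 := by rw [← hpow, hx]; rfl
  have hy' : (shift A μ ^ (m + 1)) y = 0 := by rw [← hpow, hy]; rfl
  have hxy' : jForm H x ((shift A μ ^ m) y) ≠ 0 := by rw [← hpow]; exact hxy
  have hxW := (hmem _).1 x.2
  have hyW := (hmem _).1 y.2
  rcases le_total 0 μ.im with h | h
  · exact ⟨μ, m, x, y, h, hxW, hyW, hx', hy', hxy'⟩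
  · refine ⟨starRingEnd ℂ μ, m, rmul x quatJ, rmul y quatJ, by simpa using h,
      mulVec_rmul_eq_zero hxW _, mulVec_rmul_eq_zero hyW _, ?_, ?_, ?_⟩
    · rw [shift_pow_rmul_quatJ, hx', rmul_zero_left]
    · rw [shift_pow_rmul_quatJ, hy', rmul_zero_left]
    · rw [shift_pow_rmul_quatJ, jForm_apply, sesq_rmul_left, sesq_rmul_right, ← mul_assoc,
        jPart_conj_quatJ]
      simpa [jForm_apply] using hxy'

theorem complexPart_sesq_eq_zero (hA : H * A = Aᴴ * H) {μ : ℂ} (hμ : μ.im ≠ 0) (a b : ℕ)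
    (x y : ι → Quaternion ℝ) (hx : (shift A μ ^ a) x = 0) (hy : (shift A μ ^ b) y = 0) :
    complexPart (sesq H x y) = 0 := by
  induction a generalizing x b y with
  | zero =>
    rw [pow_zero, Module.End.one_apply] at hx
    rw [hx, sesq_zero_left, complexPart_zero]
  | succ a iha =>
    induction b generalizing y with
    | zero =>
      rw [pow_zero, Module.End.one_apply] at hy
      rw [hy, sesq_zero_right, complexPart_zero]
    | succ b ihb =>
      rw [pow_succ, Module.End.mul_apply] at hx
      have h1 := iha (b + 1) (shift A μ x) y hx hy
      rw [pow_succ, Module.End.mul_apply] at hy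
      have h2 := ihb (shift A μ y) hy
      rw [shift_apply, sesq_sub_left, sesq_rmul_left, complexPart_sub, star_cq,
        complexPart_cq_mul] at h1
      rw [shift_apply, sesq_sub_right, sesq_rmul_right, complexPart_sub,
        complexPart_mul_cq, ← sesq_mulVec_left hA] at h2
      have h3 : (μ - starRingEnd ℂ μ) * complexPart (sesq H x y) = 0 := by
        linear_combination h1 - h2
      refine (mul_eq_zero.1 h3).resolve_left fun h => hμ ?_
      have := congrArg Complex.im h
      simp at this
      linarith

variable (H A) in
/-- A Jordan chain `u 0, …, u m` for the eigenvalue `q`, listed from the top down. -/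
structure IsJordanChain (q : Quaternion ℝ) (m : ℕ) (u : ℕ → ι → Quaternion ℝ) : Prop where
  step : ∀ s, A *ᵥ u s = rmul (u s) q + u (s + 1)
  last : u (m + 1) = 0

theorem exists_complex_chains [Fintype κ] (hH : H.IsHermitian) (hA : H * A = Aᴴ * H)
    {C : Matrix κ ι (Quaternion ℝ)} {D : Matrix κ κ (Quaternion ℝ)} (hC : C * A = D * C)
    {μ : ℂ} (hμ : μ.im ≠ 0) {m : ℕ} {x y : ι → Quaternion ℝ} (hxC : C *ᵥ x = 0)
    (hyC : C *ᵥ y = 0) (hx : (shift A μ ^ (m + 1)) x = 0) (hy : (shift A μ ^ (m + 1)) y = 0)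
    (hxy : jForm H x ((shift A μ ^ m) y) ≠ 0) :
    ∃ u w : ℕ → ι → Quaternion ℝ, IsJordanChain A (cq μ) m u ∧
      IsJordanChain A (cq (starRingEnd ℂ μ)) m w ∧
      (∀ s, C *ᵥ u s = 0) ∧ (∀ s, C *ᵥ w s = 0) ∧
      (∀ s t, sesq H (u s) (u t) = 0) ∧ (∀ s t, sesq H (w s) (w t) = 0) ∧
      (∀ s t, sesq H (u s) (w t) = if s + t = m then 1 else 0) := by
  let W : Submodule ℂ (ι → Quaternion ℝ) :=
    LinearMap.ker (mulVecC C) ⊓ LinearMap.ker (shift A μ ^ (m + 1))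
  have hmem : ∀ v, v ∈ W ↔ C *ᵥ v = 0 ∧ (shift A μ ^ (m + 1)) v = 0 := fun v => Iff.rfl
  have hW : ∀ v ∈ W, shift A μ v ∈ W := by
    intro v hv
    rw [hmem] at hv ⊢
    refine ⟨mulVec_shift_eq_zero hC μ hv.1, ?_⟩
    rw [← Module.End.mul_apply, ← pow_succ, pow_succ', Module.End.mul_apply, hv.2, map_zero]
  obtain ⟨z, hzW, hzm, hz⟩ := exists_normalized_functional (shift A μ) (jForm H x) W m hW
    (fun v hv => ((hmem v).1 hv).2) ((hmem y).2 ⟨hyC, hy⟩) hxy (c := -1) (by norm_num)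
  have hpow := pow_apply_mem_of_invariant hW
  have hxW : x ∈ W := (hmem x).2 ⟨hxC, hx⟩
  have hzero : ∀ v ∈ W, ∀ i, m < i → (shift A μ ^ i) v = 0 := fun v hv i hi =>
    Module.End.pow_map_zero_of_le hi ((hmem v).1 hv).2
  have hstep : ∀ (v : ι → Quaternion ℝ) (s : ℕ), A *ᵥ (shift A μ ^ s) v
      = rmul ((shift A μ ^ s) v) (cq μ) + (shift A μ ^ (s + 1)) v := by
    intro v s
    rw [mulVec_eq_rmul_add_shift μ, pow_succ', Module.End.mul_apply]
  have hadj := pow_selfAdjoint (shift_selfAdjoint hA μ)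
  have hsesq : ∀ v ∈ W, ∀ v' ∈ W, ∀ s t, sesq H ((shift A μ ^ s) v) ((shift A μ ^ t) v')
      = quatJ * cq (jForm H v ((shift A μ ^ (s + t)) v')) := by
    intro v hv v' hv' s t
    rw [eq_quatJ_mul_jPart (complexPart_sesq_eq_zero hA hμ (m + 1) (m + 1) _ _
      ((hmem _).1 (hpow s v hv)).2 ((hmem _).1 (hpow t v' hv')).2), ← jForm_apply, hadj,
      ← Module.End.mul_apply, ← pow_add]
  have hself : ∀ v ∈ W, ∀ s t, sesq H ((shift A μ ^ s) v) ((shift A μ ^ t) v) = 0 := by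
    intro v hv s t
    have h0 : jForm H v ((shift A μ ^ (s + t)) v) = 0 := by
      have h := jForm_antisymm hH v ((shift A μ ^ (s + t)) v)
      rw [hadj] at h
      exact self_eq_neg.1 h
    rw [hsesq v hv v hv, h0, cq_zero, mul_zero]
  refine ⟨fun s => (shift A μ ^ s) x, fun s => rmul ((shift A μ ^ s) z) quatJ,
    ⟨hstep x, hx⟩, ⟨fun s => ?_, ?_⟩, fun s => ((hmem _).1 (hpow s x hxW)).1,
    fun s => mulVec_rmul_eq_zero ((hmem _).1 (hpow s z hzW)).1 _, hself x hxW, fun s t => ?_,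
    fun s t => ?_⟩
  · rw [mulVec_rmul, hstep]
    ext1 i
    simp only [Pi.add_apply, rmul, add_mul, mul_assoc, cq_mul_quatJ]
  · rw [((hmem z).1 hzW).2, rmul_zero_left]
  · rw [sesq_rmul_left, sesq_rmul_right, hself z hzW, zero_mul, mul_zero]
  · rw [sesq_rmul_right, hsesq x hxW z hzW, mul_assoc, cq_mul_quatJ, ← mul_assoc,
      quatJ_mul_self]
    split_ifs with h
    · rw [h, hzm]
      simp [← cq_one]
      ext <;> simp
    · rcases lt_or_gt_of_ne h with h | h
      · rw [hz _ h]
        simp [cq_zero]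
      · rw [hzero z hzW _ h]
        simp [cq_zero]

theorem exists_sesq_self_ne_zero (hH : H.IsHermitian) (N : Matrix ι ι (Quaternion ℝ))
    (hN : H * N = Nᴴ * H) {x y : ι → Quaternion ℝ} (hxy : sesq H x (N *ᵥ y) ≠ 0) :
    ∃ q r : Quaternion ℝ, sesq H (rmul x q + rmul y r) (N *ᵥ (rmul x q + rmul y r)) ≠ 0 := by
  by_contra! h
  have hr : ∀ v q, N *ᵥ rmul v q = rmul (N *ᵥ v) q := fun v q => mulVec_rmul N v q
  have hx := h 1 0
  have hy := h 0 1
  have h1 := h 1 (star (sesq H x (N *ᵥ y)))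
  simp only [mulVec_add, hr, sesq_add_left, sesq_add_right, sesq_rmul_left, sesq_rmul_right,
    star_one, star_zero, one_mul, mul_one, zero_mul, mul_zero, add_zero, zero_add,
    star_star] at hx hy h1
  rw [hx, hy, ← sesq_mulVec_left hN y x, ← star_sesq hH] at h1
  rw [← star_sesq hH] at hxy
  rw [star_star, zero_add, mul_zero, add_zero, ← two_smul ℝ] at h1
  exact mul_ne_zero hxy (star_ne_zero.1 hxy) ((smul_eq_zero.1 h1).resolve_left two_ne_zero)

theorem exists_real_chain [Fintype κ] [DecidableEq ι] (hH : H.IsHermitian)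
    (hA : H * A = Aᴴ * H)
    {C : Matrix κ ι (Quaternion ℝ)} {D : Matrix κ κ (Quaternion ℝ)} (hC : C * A = D * C)
    {r : ℝ} {m : ℕ} {x y : ι → Quaternion ℝ} (hxC : C *ᵥ x = 0)
    (hyC : C *ᵥ y = 0) (hx : (shift A r ^ (m + 1)) x = 0) (hy : (shift A r ^ (m + 1)) y = 0)
    (hxy : jForm H x ((shift A r ^ m) y) ≠ 0) :
    ∃ (η : ℝ) (u : ℕ → ι → Quaternion ℝ), (η = 1 ∨ η = -1) ∧
      IsJordanChain A (algebraMap ℝ (Quaternion ℝ) r) m u ∧ (∀ s, C *ᵥ u s = 0) ∧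
      (∀ s t, sesq H (u s) (u t) = if s + t = m then η • 1 else 0) := by
  let N : Matrix ι ι (Quaternion ℝ) := A - r • 1
  have hshift : ∀ v, shift A r v = N *ᵥ v := by
    intro v
    rw [shift_apply, sub_mulVec, smul_mulVec, one_mulVec, cq_ofReal]
    congr 1
    ext1 i
    rw [rmul, Pi.smul_apply, Algebra.smul_def, Algebra.commutes]
  have hpowM : ∀ k v, (shift A r ^ k) v = (N ^ k) *ᵥ v := by
    intro k
    induction k with
    | zero => simp
    | succ k ih => intro v; rw [pow_succ, Module.End.mul_apply, ih, hshift, mulVec_mulVec,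
        pow_succ]
  have hpowR : ∀ k v, (mulVecR N ^ k) v = (N ^ k) *ᵥ v := by
    intro k
    induction k with
    | zero => simp
    | succ k ih => intro v; rw [pow_succ, Module.End.mul_apply, ih, mulVecR_apply,
        mulVec_mulVec, pow_succ]
  have hN : H * N = Nᴴ * H := by
    have h1 : (r • (1 : Matrix ι ι (Quaternion ℝ)))ᴴ = r • 1 := by
      ext1 i j
      rw [conjTranspose_apply, Matrix.smul_apply, Quaternion.star_smul, ← conjTranspose_apply,
        conjTranspose_one, Matrix.smul_apply]
    rw [mul_sub, hA, conjTranspose_sub, sub_mul, h1, Matrix.mul_smul, Matrix.smul_mul,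
      Matrix.mul_one, Matrix.one_mul]
  have hNpow : ∀ k, H * N ^ k = (N ^ k)ᴴ * H := by
    intro k
    induction k with
    | zero => simp
    | succ k ih =>
      rw [pow_succ, ← mul_assoc, ih, mul_assoc, hN, ← mul_assoc, ← conjTranspose_mul,
        ← pow_succ', pow_succ]
  let W : Submodule ℝ (ι → Quaternion ℝ) :=
    LinearMap.ker (mulVecR C) ⊓ LinearMap.ker (mulVecR N ^ (m + 1))
  have hmem : ∀ v, v ∈ W ↔ C *ᵥ v = 0 ∧ (N ^ (m + 1)) *ᵥ v = 0 := by
    intro v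
    rw [← hpowR]
    exact Iff.rfl
  have hW : ∀ v ∈ W, mulVecR N v ∈ W := by
    intro v hv
    rw [hmem] at hv ⊢
    rw [mulVecR_apply, ← hshift]
    refine ⟨mulVec_shift_eq_zero hC r hv.1, ?_⟩
    rw [hshift, mulVec_mulVec, ← pow_succ, pow_succ', ← mulVec_mulVec, hv.2, mulVec_zero]
  obtain ⟨p, q, hv⟩ := exists_sesq_self_ne_zero hH (N ^ m) (hNpow m) (x := x) (y := y) (by
    intro h
    rw [hpowM, jForm_apply, h, jPart_zero] at hxy
    exact hxy rfl)
  have hreal : ∀ k v, sesq H v (N ^ k *ᵥ v) = ((sesq H v (N ^ k *ᵥ v)).re : Quaternion ℝ) := by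
    intro k v
    rw [← Quaternion.star_eq_self, star_sesq hH, sesq_mulVec_left (hNpow k)]
  have hvW : rmul x p + rmul y q ∈ W := by
    rw [hpowM] at hx hy
    rw [hmem, mulVec_add, mulVec_add, mulVec_rmul_eq_zero hxC, mulVec_rmul_eq_zero hyC,
      mulVec_rmul_eq_zero hx, mulVec_rmul_eq_zero hy, add_zero, add_zero]
    exact ⟨rfl, rfl⟩
  obtain ⟨z, hzW, hzm, hz⟩ := exists_normalized_vector (mulVecR N) (reForm H)
    (fun v w => by rw [reForm_apply, reForm_apply, mulVecR_apply, mulVecR_apply,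
      sesq_mulVec_left hN]) W m hW
    (fun v hv => ((hmem v).1 hv).2 ▸ hpowR _ v) hvW (by
      intro h
      rw [hpowR, reForm_apply] at h
      rw [hreal, h] at hv
      exact hv rfl)
  simp only [hpowR, reForm_apply] at hzm hz
  have hpow := pow_apply_mem_of_invariant hW
  simp only [hpowR] at hpow
  refine ⟨(sesq H z (N ^ m *ᵥ z)).re, fun s => N ^ s *ᵥ z, hzm, ⟨fun s => ?_, ((hmem z).1 hzW).2⟩,
    fun s => ((hmem _).1 (hpow s z hzW)).1, fun s t => ?_⟩
  · rw [mulVec_eq_rmul_add_shift r, hshift, cq_ofReal, mulVec_mulVec, ← pow_succ']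
  · rw [sesq_mulVec_left (hNpow s), mulVec_mulVec, ← pow_add]
    split_ifs with h
    · rw [h]
      rw [← Algebra.algebraMap_eq_smul_one, Quaternion.algebraMap_def, ← hreal]
    · rcases lt_or_gt_of_ne h with h | h
      · rw [hreal, hz _ h]; rfl
      · rw [← hpowR, Module.End.pow_map_zero_of_le h (hpowR _ z ▸ ((hmem z).1 hzW).2),
          sesq_zero_right]

theorem conjTranspose_mul_mul_apply {κ' : Type*} (X : Matrix ι κ (Quaternion ℝ))
    (Y : Matrix ι κ' (Quaternion ℝ)) (i : κ) (j : κ') :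
    (Xᴴ * H * Y) i j = sesq H (fun p => X p i) (fun p => Y p j) := by
  rw [Matrix.mul_assoc]
  rfl

theorem exists_mulVec_eq_zero_of_card_lt [Fintype κ] (C : Matrix κ ι (Quaternion ℝ))
    (h : Fintype.card κ < Fintype.card ι) : ∃ y, C *ᵥ y = 0 ∧ y ≠ 0 := by
  have hlt : Module.finrank ℝ (κ → Quaternion ℝ) < Module.finrank ℝ (ι → Quaternion ℝ) := by
    simp only [Module.finrank_pi_fintype, Quaternion.finrank_eq_four, Finset.sum_const,
      Finset.card_univ, smul_eq_mul]
    omega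
  obtain ⟨y, hy, hy0⟩ := (Submodule.ne_bot_iff _).1
    (LinearMap.ker_ne_bot_of_finrank_lt (f := mulVecR C) hlt)
  exact ⟨y, hy, hy0⟩

theorem card_le_of_mul_eq_one [Fintype κ] [DecidableEq κ] {T : Matrix κ ι (Quaternion ℝ)}
    {X : Matrix ι κ (Quaternion ℝ)} (h : T * X = 1) : Fintype.card κ ≤ Fintype.card ι := by
  by_contra! hlt
  obtain ⟨y, hy, hy0⟩ := exists_mulVec_eq_zero_of_card_lt X hlt
  apply hy0
  rw [← one_mulVec y, ← h, ← mulVec_mulVec, hy, mulVec_zero]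

theorem eq_zero_of_sesq_eq_zero [DecidableEq ι] (hHu : IsUnit H) {y : ι → Quaternion ℝ}
    (h : ∀ z, sesq H z y = 0) : y = 0 := by
  have hHy : H *ᵥ y = 0 := by
    ext1 i
    have hi := h (Pi.single i 1)
    rw [sesq, ← Pi.single_star, star_one, single_dotProduct, one_mul] at hi
    exact hi
  obtain ⟨T, hT⟩ := hHu.exists_left_inv
  rw [← one_mulVec y, ← hT, ← mulVec_mulVec, hHy, mulVec_zero]

theorem eq_zero_of_sesq_ker_eq_zero [Fintype κ] [DecidableEq κ] [DecidableEq ι]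
    (hHu : IsUnit H) {X : Matrix ι κ (Quaternion ℝ)} {Q : Matrix κ κ (Quaternion ℝ)}
    (hX : Xᴴ * H * X = Q) (hQ : Q * Q = 1) {y : ι → Quaternion ℝ}
    (hy : (Xᴴ * H) *ᵥ y = 0) (h : ∀ x, (Xᴴ * H) *ᵥ x = 0 → sesq H x y = 0) : y = 0 := by
  refine eq_zero_of_sesq_eq_zero hHu fun z => ?_
  have h1 := h (z - X *ᵥ (Q *ᵥ ((Xᴴ * H) *ᵥ z))) (by
    rw [mulVec_sub, mulVec_mulVec _ (Xᴴ * H) X, hX, mulVec_mulVec _ Q Q, hQ, one_mulVec,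
      sub_self])
  rw [sesq_sub_left] at h1
  have h2 : sesq H (X *ᵥ (Q *ᵥ ((Xᴴ * H) *ᵥ z))) y = 0 := by
    rw [sesq, star_mulVec, ← dotProduct_mulVec, mulVec_mulVec y Xᴴ H, hy,
      dotProduct_zero]
  rwa [h2, sub_zero] at h1

/-- The matrix whose columns are `u m, …, u 0`. -/
def chainMatrix (m : ℕ) (u : ℕ → ι → Quaternion ℝ) : Matrix ι (Fin (m + 1)) (Quaternion ℝ) :=
  Matrix.of fun p c => u (m - c) p

theorem mul_chainMatrix {q : Quaternion ℝ} {m : ℕ} {u : ℕ → ι → Quaternion ℝ}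
    (h : IsJordanChain A q m u) :
    A * chainMatrix m u = chainMatrix m u * jordanBlock q (m + 1) := by
  ext1 p c
  have h1 : (A * chainMatrix m u) p c = (A *ᵥ u (m - c)) p := rfl
  have h2 : ∀ d, jordanBlock q (m + 1) d c
      = (if d = c then q else 0) + (if (d : ℕ) + 1 = c then 1 else 0) := by
    intro d
    simp only [jordanBlock, Matrix.of_apply, Fin.ext_iff]
    split_ifs <;> first | omega | simp
  rw [h1, h.step, Matrix.mul_apply]
  simp only [h2, mul_add, mul_ite, mul_zero, mul_one, Finset.sum_add_distrib,
    Finset.sum_ite_eq', Finset.mem_univ, if_true, Pi.add_apply]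
  congr 1
  cases c using Fin.cases with
  | zero => simp [h.last]
  | succ c =>
    rw [Finset.sum_eq_single c.castSucc]
    · simp only [chainMatrix, Matrix.of_apply, Fin.val_castSucc, Fin.val_succ, if_true]
      congr 1
      omega
    · intro d _ hd
      rw [if_neg]
      intro h
      apply hd
      rw [Fin.val_succ] at h
      exact Fin.ext (by rw [Fin.val_castSucc]; omega)
    · simp

theorem mul_chainMatrix_eq_zero {C : Matrix κ ι (Quaternion ℝ)} {u : ℕ → ι → Quaternion ℝ}
    (h : ∀ s, C *ᵥ u s = 0) (m : ℕ) : C * chainMatrix m u = 0 := by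
  ext1 i c
  exact congrFun (h (m - c)) i

theorem gram_chainMatrix {m : ℕ} {u w : ℕ → ι → Quaternion ℝ} {η : ℝ}
    (h : ∀ s t, sesq H (u s) (w t) = if s + t = m then η • 1 else 0) :
    (chainMatrix m u)ᴴ * H * chainMatrix m w = η • sip (Quaternion ℝ) (m + 1) := by
  ext1 i j
  have h1 : sesq H (fun p => chainMatrix m u p i) (fun p => chainMatrix m w p j)
    = sesq H (u (m - i)) (w (m - j)) := rfl
  rw [conjTranspose_mul_mul_apply, h1, h, Matrix.smul_apply, sip, Matrix.of_apply]
  have h2 : m - (i : ℕ) + (m - j) = m ↔ (i : ℕ) + j = m + 1 - 1 := by omega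
  simp only [h2]
  split_ifs <;> simp

theorem gram_chainMatrix_eq_zero {m : ℕ} {u w : ℕ → ι → Quaternion ℝ}
    (h : ∀ s t, sesq H (u s) (w t) = 0) : (chainMatrix m u)ᴴ * H * chainMatrix m w = 0 := by
  ext1 i j
  rw [conjTranspose_mul_mul_apply]
  exact h _ _

end RightModule

theorem sip_mul_sip (k : ℕ) : sip (Quaternion ℝ) k * sip (Quaternion ℝ) k = 1 := by
  have h : sip (Quaternion ℝ) k = Matrix.of fun i j => if i.rev = j then 1 else 0 := by
    ext1 i j
    simp only [sip, Matrix.of_apply, Fin.ext_iff, Fin.val_rev]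
    congr 1
    apply propext
    omega
  ext1 i j
  rw [h, Matrix.mul_apply]
  simp only [Matrix.of_apply]
  rw [Finset.sum_eq_single i.rev]
  · simp [Matrix.one_apply]
  · intro l _ hl
    rw [if_neg hl.symm, zero_mul]
  · simp

theorem sip_two_mul (k : ℕ) : sip (Quaternion ℝ) (2 * k)
    = (fromBlocks 0 (sip (Quaternion ℝ) k) (sip (Quaternion ℝ) k) 0).submatrix
      (finTwoMul k).symm (finTwoMul k).symm := by
  ext1 i j
  obtain ⟨i, rfl⟩ := (finTwoMul k).surjective i
  obtain ⟨j, rfl⟩ := (finTwoMul k).surjective j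
  have hl : ∀ a : Fin k, (finTwoMul k (Sum.inl a) : ℕ) = a := fun a => rfl
  have hr : ∀ a : Fin k, (finTwoMul k (Sum.inr a) : ℕ) = k + a := fun a => rfl
  rw [submatrix_apply, Equiv.symm_apply_apply, Equiv.symm_apply_apply]
  rcases i with i | i <;> rcases j with j | j <;>
    simp only [sip, Matrix.of_apply, hl, hr, fromBlocks_apply₁₁, fromBlocks_apply₁₂,
      fromBlocks_apply₂₁, fromBlocks_apply₂₂, Matrix.zero_apply]
  · rw [if_neg (by omega)]
  · congr 1; apply propext; omega
  · congr 1; apply propext; omega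
  · rw [if_neg (by omega)]

section Concat

variable {ι I : Type*} [Fintype ι] [DecidableEq I] {d : I → ℕ}

/-- Juxtaposition of a family of matrices with the same rows. -/
def concatCols (X : ∀ i, Matrix ι (Fin (d i)) (Quaternion ℝ)) :
    Matrix ι ((i : I) × Fin (d i)) (Quaternion ℝ) :=
  Matrix.of fun p s => X s.1 p s.2

theorem mul_concatCols [Fintype I] {A : Matrix ι ι (Quaternion ℝ)}
    {X : ∀ i, Matrix ι (Fin (d i)) (Quaternion ℝ)}
    {J : ∀ i, Matrix (Fin (d i)) (Fin (d i)) (Quaternion ℝ)}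
    (h : ∀ i, A * X i = X i * J i) :
    A * concatCols X = concatCols X * blockDiagonal' J := by
  ext1 p ⟨i, t⟩
  have h1 : (A * concatCols X) p ⟨i, t⟩ = (A * X i) p t := rfl
  rw [h1, h, Matrix.mul_apply, Matrix.mul_apply, Fintype.sum_sigma, Finset.sum_eq_single i]
  · simp [concatCols]
  · intro j _ hj
    simp [blockDiagonal'_apply_ne _ _ _ hj]
  · simp

theorem gram_concatCols {H : Matrix ι ι (Quaternion ℝ)}
    {X : ∀ i, Matrix ι (Fin (d i)) (Quaternion ℝ)}
    {Q : ∀ i, Matrix (Fin (d i)) (Fin (d i)) (Quaternion ℝ)}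
    (h : ∀ i, (X i)ᴴ * H * X i = Q i) (h' : ∀ i j, i ≠ j → (X i)ᴴ * H * X j = 0) :
    (concatCols X)ᴴ * H * concatCols X = blockDiagonal' Q := by
  ext1 ⟨i, s⟩ ⟨j, t⟩
  have h1 : ((concatCols X)ᴴ * H * concatCols X) ⟨i, s⟩ ⟨j, t⟩ = ((X i)ᴴ * H * X j) s t := rfl
  rw [h1]
  by_cases hij : i = j
  · subst hij
    rw [h, blockDiagonal'_apply_eq]
  · rw [h' i j hij, blockDiagonal'_apply_ne _ _ _ hij, Matrix.zero_apply]

end Concat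

section Blocks

variable {n : ℕ} {H A : Matrix (Fin n) (Fin n) (Quaternion ℝ)}

variable (H A) in
/-- Columns on which `A` acts as a real Jordan block and `H` has Gram matrix `± Q_k`. -/
structure RealBlock where
  k : ℕ
  lr : ℝ
  η : ℝ
  cols : Matrix (Fin n) (Fin k) (Quaternion ℝ)
  k_pos : 0 < k
  η_eq : η = 1 ∨ η = -1
  mul_cols : A * cols = cols * jordanBlock (algebraMap ℝ (Quaternion ℝ) lr) k
  gram : colsᴴ * H * cols = η • sip (Quaternion ℝ) k

variable (H A) in
/-- Columns on which `A` acts as a pair of conjugate Jordan blocks and `H` has Gram matrix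
`Q_{2l}`. -/
structure ComplexBlock where
  l : ℕ
  lc : ℂ
  cols : Matrix (Fin n) (Fin (2 * l)) (Quaternion ℝ)
  l_pos : 0 < l
  im_pos : 0 < lc.im
  mul_cols : A * cols
    = cols * dsum2 (jordanBlock (cq lc) l) (jordanBlock (cq (starRingEnd ℂ lc)) l)
  gram : colsᴴ * H * cols = sip (Quaternion ℝ) (2 * l)

theorem exists_realBlock {κ : Type*} {C : Matrix κ (Fin n) (Quaternion ℝ)} {η r : ℝ} {m : ℕ}
    {u : ℕ → Fin n → Quaternion ℝ} (hη : η = 1 ∨ η = -1)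
    (hu : IsJordanChain A (algebraMap ℝ (Quaternion ℝ) r) m u) (hCu : ∀ s, C *ᵥ u s = 0)
    (huu : ∀ s t, sesq H (u s) (u t) = if s + t = m then η • 1 else 0) :
    ∃ b : RealBlock H A, C * b.cols = 0 :=
  ⟨⟨m + 1, r, η, chainMatrix m u, m.succ_pos, hη, mul_chainMatrix hu, gram_chainMatrix huu⟩,
    mul_chainMatrix_eq_zero hCu m⟩

theorem exists_complexBlock {κ : Type*} {C : Matrix κ (Fin n) (Quaternion ℝ)} {μ : ℂ} {m : ℕ}
    {u w : ℕ → Fin n → Quaternion ℝ} (hH : H.IsHermitian) (hμ : 0 < μ.im)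
    (hu : IsJordanChain A (cq μ) m u) (hw : IsJordanChain A (cq (starRingEnd ℂ μ)) m w)
    (hCu : ∀ s, C *ᵥ u s = 0) (hCw : ∀ s, C *ᵥ w s = 0)
    (huu : ∀ s t, sesq H (u s) (u t) = 0) (hww : ∀ s t, sesq H (w s) (w t) = 0)
    (huw : ∀ s t, sesq H (u s) (w t) = if s + t = m then 1 else 0) :
    ∃ b : ComplexBlock H A, C * b.cols = 0 := by
  have huw' : (chainMatrix m u)ᴴ * H * chainMatrix m w = sip (Quaternion ℝ) (m + 1) := by
    rw [gram_chainMatrix (η := 1) (by simpa using huw), one_smul]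
  have hwu' : (chainMatrix m w)ᴴ * H * chainMatrix m u = sip (Quaternion ℝ) (m + 1) := by
    rw [gram_chainMatrix (η := 1), one_smul]
    intro s t
    rw [← star_sesq hH, huw, add_comm t s, one_smul]
    split_ifs <;> simp
  have hequiv : ∀ {α β γ : Type} (M : Matrix α (Fin (m + 1) ⊕ Fin (m + 1)) (Quaternion ℝ))
      (N : Matrix (Fin (m + 1) ⊕ Fin (m + 1)) β (Quaternion ℝ)) (f : γ → β),
      M.submatrix id (finTwoMul (m + 1)).symm * N.submatrix (finTwoMul (m + 1)).symm f
        = (M * N).submatrix id f :=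
    fun M N f => submatrix_mul_equiv M N id _ f
  refine ⟨⟨m + 1, μ, (fromCols (chainMatrix m u) (chainMatrix m w)).submatrix id
    (finTwoMul (m + 1)).symm, m.succ_pos, hμ, ?_, ?_⟩, ?_⟩
  · rw [dsum2, reindex_apply, hequiv, fromCols_mul_fromBlocks, Matrix.mul_zero, Matrix.mul_zero,
      add_zero, zero_add, ← mul_chainMatrix hu, ← mul_chainMatrix hw, ← mul_fromCols]
    rfl
  · have h : ∀ M : Matrix (Fin n) (Fin (m + 1) ⊕ Fin (m + 1)) (Quaternion ℝ),
        (M.submatrix id (finTwoMul (m + 1)).symm)ᴴ * H * M.submatrix id (finTwoMul (m + 1)).symm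
          = (Mᴴ * H * M).submatrix (finTwoMul (m + 1)).symm (finTwoMul (m + 1)).symm :=
      fun M => rfl
    rw [h, sip_two_mul, conjTranspose_fromCols_eq_fromRows_conjTranspose, fromRows_mul,
      fromRows_mul_fromCols, huw', hwu', gram_chainMatrix_eq_zero huu,
      gram_chainMatrix_eq_zero hww]
  · have h : C * (fromCols (chainMatrix m u) (chainMatrix m w)) = 0 := by
      rw [mul_fromCols, mul_chainMatrix_eq_zero hCu, mul_chainMatrix_eq_zero hCw, fromCols_zero]
    exact congrArg (fun M => M.submatrix id (finTwoMul (m + 1)).symm) h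

variable {a g : ℕ}

/-- The sizes of a family of blocks. -/
abbrev blockSize (r : Fin a → RealBlock H A) (c : Fin g → ComplexBlock H A) :
    Fin a ⊕ Fin g → ℕ :=
  Sum.elim (fun j => (r j).k) (fun j => 2 * (c j).l)

/-- The columns of a family of blocks. -/
def blockCols (r : Fin a → RealBlock H A) (c : Fin g → ComplexBlock H A) :
    ∀ i, Matrix (Fin n) (Fin (blockSize r c i)) (Quaternion ℝ) :=
  Sum.rec (fun j => (r j).cols) (fun j => (c j).cols)

/-- The Jordan blocks of a family of blocks. -/
def blockJordan (r : Fin a → RealBlock H A) (c : Fin g → ComplexBlock H A) :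
    ∀ i, Matrix (Fin (blockSize r c i)) (Fin (blockSize r c i)) (Quaternion ℝ) :=
  Sum.rec (fun j => jordanBlock (algebraMap ℝ (Quaternion ℝ) (r j).lr) (r j).k)
    (fun j => dsum2 (jordanBlock (cq (c j).lc) (c j).l)
      (jordanBlock (cq (starRingEnd ℂ (c j).lc)) (c j).l))

/-- The Gram matrices of a family of blocks. -/
def blockGram (r : Fin a → RealBlock H A) (c : Fin g → ComplexBlock H A) :
    ∀ i, Matrix (Fin (blockSize r c i)) (Fin (blockSize r c i)) (Quaternion ℝ) :=
  Sum.rec (fun j => (r j).η • sip (Quaternion ℝ) (r j).k)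
    (fun j => sip (Quaternion ℝ) (2 * (c j).l))

/-- The blocks of a family are pairwise `H`-orthogonal. -/
def BlocksOrthogonal (r : Fin a → RealBlock H A) (c : Fin g → ComplexBlock H A) : Prop :=
  ∀ i j, i ≠ j → (blockCols r c i)ᴴ * H * blockCols r c j = 0

variable {r : Fin a → RealBlock H A} {c : Fin g → ComplexBlock H A}

theorem mul_concatCols_blockCols : A * concatCols (blockCols r c)
    = concatCols (blockCols r c) * blockDiagonal' (blockJordan r c) :=
  mul_concatCols (Sum.rec (fun j => (r j).mul_cols) (fun j => (c j).mul_cols))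

theorem BlocksOrthogonal.gram (h : BlocksOrthogonal r c) :
    (concatCols (blockCols r c))ᴴ * H * concatCols (blockCols r c)
      = blockDiagonal' (blockGram r c) :=
  gram_concatCols (Sum.rec (fun j => (r j).gram) (fun j => (c j).gram)) h

theorem blockDiagonal'_blockGram_mul_self :
    blockDiagonal' (blockGram r c) * blockDiagonal' (blockGram r c) = 1 := by
  rw [← blockDiagonal'_mul, ← blockDiagonal'_one]
  congr 1
  funext i
  rcases i with j | j
  · change ((r j).η • sip (Quaternion ℝ) (r j).k) * ((r j).η • sip (Quaternion ℝ) (r j).k) = 1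
    rw [Matrix.smul_mul, Matrix.mul_smul, smul_smul, sip_mul_sip]
    rcases (r j).η_eq with h | h <;> simp [h]
  · exact sip_mul_sip _

theorem conjTranspose_mul_mul_eq_zero {κ κ' : Type*} (hH : H.IsHermitian)
    {X : Matrix (Fin n) κ (Quaternion ℝ)} {Y : Matrix (Fin n) κ' (Quaternion ℝ)}
    (h : Xᴴ * H * Y = 0) : Yᴴ * H * X = 0 := by
  have h' := congrArg conjTranspose h
  rwa [conjTranspose_mul, conjTranspose_mul, conjTranspose_conjTranspose, hH.eq,
    conjTranspose_zero, ← Matrix.mul_assoc] at h'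

theorem BlocksOrthogonal.cons_real (h : BlocksOrthogonal r c) (hH : H.IsHermitian)
    {b : RealBlock H A} (hb : ∀ i, (blockCols r c i)ᴴ * H * b.cols = 0) :
    BlocksOrthogonal (Fin.cons b r : Fin (a + 1) → RealBlock H A) c := by
  have hb' : ∀ i, b.colsᴴ * H * blockCols r c i = 0 :=
    fun i => conjTranspose_mul_mul_eq_zero hH (hb i)
  rintro (i | i) (j | j) hij
  · cases i using Fin.cases with
    | zero =>
      cases j using Fin.cases with
      | zero => exact absurd rfl hij
      | succ j => exact hb' (Sum.inl j)
    | succ i =>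
      cases j using Fin.cases with
      | zero => exact hb (Sum.inl i)
      | succ j => exact h (Sum.inl i) (Sum.inl j) (by rintro ⟨⟩; exact hij rfl)
  · cases i using Fin.cases with
    | zero => exact hb' (Sum.inr j)
    | succ i => exact h (Sum.inl i) (Sum.inr j) Sum.inl_ne_inr
  · cases j using Fin.cases with
    | zero => exact hb (Sum.inr i)
    | succ j => exact h (Sum.inr i) (Sum.inl j) Sum.inr_ne_inl
  · exact h (Sum.inr i) (Sum.inr j) (by rintro ⟨⟩; exact hij rfl)

theorem BlocksOrthogonal.cons_complex (h : BlocksOrthogonal r c) (hH : H.IsHermitian)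
    {b : ComplexBlock H A} (hb : ∀ i, (blockCols r c i)ᴴ * H * b.cols = 0) :
    BlocksOrthogonal r (Fin.cons b c : Fin (g + 1) → ComplexBlock H A) := by
  have hb' : ∀ i, b.colsᴴ * H * blockCols r c i = 0 :=
    fun i => conjTranspose_mul_mul_eq_zero hH (hb i)
  rintro (i | i) (j | j) hij
  · exact h (Sum.inl i) (Sum.inl j) (by rintro ⟨⟩; exact hij rfl)
  · cases j using Fin.cases with
    | zero => exact hb (Sum.inl i)
    | succ j => exact h (Sum.inl i) (Sum.inr j) Sum.inl_ne_inr
  · cases i using Fin.cases with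
    | zero => exact hb' (Sum.inl j)
    | succ i => exact h (Sum.inr i) (Sum.inl j) Sum.inr_ne_inl
  · cases i using Fin.cases with
    | zero =>
      cases j using Fin.cases with
      | zero => exact absurd rfl hij
      | succ j => exact hb' (Sum.inr j)
    | succ i =>
      cases j using Fin.cases with
      | zero => exact hb (Sum.inr i)
      | succ j => exact h (Sum.inr i) (Sum.inr j) (by rintro ⟨⟩; exact hij rfl)

theorem BlocksOrthogonal.sum_blockSize_le (h : BlocksOrthogonal r c) :
    ∑ i, blockSize r c i ≤ n := by
  have hT : blockDiagonal' (blockGram r c) * ((concatCols (blockCols r c))ᴴ * H)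
      * concatCols (blockCols r c) = 1 := by
    rw [Matrix.mul_assoc, h.gram, blockDiagonal'_blockGram_mul_self]
  simpa using card_le_of_mul_eq_one hT

theorem BlocksOrthogonal.exists_block (h : BlocksOrthogonal r c) (hHu : IsUnit H)
    (hH : H.IsHermitian) (hA : H * A = Aᴴ * H) (hlt : ∑ i, blockSize r c i < n) :
    (∃ b : RealBlock H A, ∀ i, (blockCols r c i)ᴴ * H * b.cols = 0) ∨
      ∃ b : ComplexBlock H A, ∀ i, (blockCols r c i)ᴴ * H * b.cols = 0 := by
  let C := (concatCols (blockCols r c))ᴴ * H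
  have hsplit : ∀ {k : ℕ} {Y : Matrix (Fin n) (Fin k) (Quaternion ℝ)}, C * Y = 0 →
      ∀ i, (blockCols r c i)ᴴ * H * Y = 0 := by
    intro k Y hY i
    ext1 s t
    exact congrFun (congrFun hY ⟨i, s⟩) t
  have hC : C * A = (blockDiagonal' (blockJordan r c))ᴴ * C := by
    rw [Matrix.mul_assoc, hA, ← Matrix.mul_assoc, ← conjTranspose_mul, mul_concatCols_blockCols,
      conjTranspose_mul, Matrix.mul_assoc]
  obtain ⟨μ, m, x, y, hμ, hxC, hyC, hx, hy, hxy⟩ := exists_root_vectors_ker hA hC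
    (fun y hy hz => eq_zero_of_sesq_ker_eq_zero hHu h.gram blockDiagonal'_blockGram_mul_self hy hz)
    (exists_mulVec_eq_zero_of_card_lt C (by simpa using hlt))
  rcases hμ.eq_or_lt with hμ | hμ
  · left
    obtain ⟨ρ, rfl⟩ : ∃ ρ : ℝ, (ρ : ℂ) = μ := ⟨μ.re, Complex.ext rfl hμ⟩
    obtain ⟨η, u, hη, hu, hCu, huu⟩ := exists_real_chain hH hA hC hxC hyC hx hy hxy
    obtain ⟨b, hb⟩ := exists_realBlock hη hu hCu huu
    exact ⟨b, hsplit hb⟩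
  · right
    obtain ⟨u, w, hu, hw, hCu, hCw, huu, hww, huw⟩ :=
      exists_complex_chains hH hA hC hμ.ne' hxC hyC hx hy hxy
    obtain ⟨b, hb⟩ := exists_complexBlock hH hμ hu hw hCu hCw huu hww huw
    exact ⟨b, hsplit hb⟩

theorem exists_blocks_of_le (hHu : IsUnit H) (hH : H.IsHermitian) (hA : H * A = Aᴴ * H) (s : ℕ)
    (hs : s ≤ n) : ∃ (a g : ℕ) (r : Fin a → RealBlock H A) (c : Fin g → ComplexBlock H A),
      BlocksOrthogonal r c ∧ s ≤ ∑ i, blockSize r c i := by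
  induction s with
  | zero =>
    refine ⟨0, 0, Fin.elim0, Fin.elim0, ?_, Nat.zero_le _⟩
    rintro (i | i)
    · exact i.elim0
    · exact i.elim0
  | succ s ih =>
    obtain ⟨a, g, r, c, h, hle⟩ := ih (Nat.le_of_succ_le hs)
    by_cases hlt : s < ∑ i, blockSize r c i
    · exact ⟨a, g, r, c, h, hlt⟩
    rcases h.exists_block hHu hH hA (by omega) with ⟨b, hb⟩ | ⟨b, hb⟩
    · refine ⟨a + 1, g, Fin.cons b r, c, h.cons_real hH hb, ?_⟩
      have := b.k_pos
      simp only [Fintype.sum_sum_type, Sum.elim_inl, Sum.elim_inr, Fin.sum_univ_succ,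
        Fin.cons_zero, Fin.cons_succ] at hle ⊢
      omega
    · refine ⟨a, g + 1, r, Fin.cons b c, h.cons_complex hH hb, ?_⟩
      have := b.l_pos
      simp only [Fintype.sum_sum_type, Sum.elim_inl, Sum.elim_inr, Fin.sum_univ_succ,
        Fin.cons_zero, Fin.cons_succ] at hle ⊢
      omega

end Blocks

/-- **Theorem (canonical form of an `H`-selfadjoint quaternion matrix).**
There is an invertible `S` (with inverse `T`) bringing `(A, H)` into the canonical form:
real-eigenvalue Jordan blocks `J_{k_j}(λ_j)` with signed sip matrices `η_j Q_{k_j}`, and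
paired Jordan blocks `J_{k_j}(λ_j) ⊕ J_{k_j}(conj λ_j)` (with `λ_j` of positive imaginary
part, viewed as quaternions) with sip matrices `Q_{2k_j}`. -/
theorem quaternion_canonical_form {n : ℕ} (H A : Matrix (Fin n) (Fin n) (Quaternion ℝ))
    (hHu : IsUnit H) (hHherm : H.IsHermitian) (hAsa : H * A = Aᴴ * H) :
    ∃ (a g : ℕ) (k : Fin a → ℕ) (l : Fin g → ℕ) (lr : Fin a → ℝ) (lc : Fin g → ℂ)
      (η : Fin a → ℝ)
      (e : ((i : Fin a ⊕ Fin g) × Fin (Sum.elim k (fun j => 2 * l j) i)) ≃ Fin n)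
      (S T : Matrix (Fin n) (Fin n) (Quaternion ℝ)),
      (∀ j, 0 < (lc j).im) ∧
      (∀ j, η j = 1 ∨ η j = -1) ∧
      S * T = 1 ∧ T * S = 1 ∧
      T * A * S = Matrix.reindex e e (Matrix.blockDiagonal'
        (fun i : Fin a ⊕ Fin g =>
          match i with
          | Sum.inl j => jordanBlock (algebraMap ℝ (Quaternion ℝ) (lr j)) (k j)
          | Sum.inr j => dsum2 (jordanBlock (cq (lc j)) (l j))
              (jordanBlock (cq (starRingEnd ℂ (lc j))) (l j)))) ∧
      Sᴴ * H * S = Matrix.reindex e e (Matrix.blockDiagonal'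
        (fun i : Fin a ⊕ Fin g =>
          match i with
          | Sum.inl j => η j • sip (Quaternion ℝ) (k j)
          | Sum.inr j => sip (Quaternion ℝ) (2 * l j))) := by
  obtain ⟨a, g, r, c, h, hle⟩ := exists_blocks_of_le hHu hHherm hAsa n le_rfl
  have hcard : Fintype.card ((i : Fin a ⊕ Fin g) × Fin (blockSize r c i)) = n := by
    simpa using le_antisymm h.sum_blockSize_le hle
  let e := Fintype.equivFinOfCardEq hcard
  let X := concatCols (blockCols r c)
  let J := blockDiagonal' (blockJordan r c)
  let Q := blockDiagonal' (blockGram r c)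
  have hQQ : reindex e e Q * reindex e e Q = 1 := by
    simp only [reindex_apply]
    rw [submatrix_mul_equiv, blockDiagonal'_blockGram_mul_self, submatrix_one_equiv]
  let S : Matrix (Fin n) (Fin n) (Quaternion ℝ) := X.submatrix id e.symm
  have hgram : Sᴴ * H * S = reindex e e Q :=
    congrArg (reindex e e) h.gram
  have hAS : A * S = S * reindex e e J := by
    have h1 : A * S = (A * X).submatrix id e.symm := rfl
    rw [h1, mul_concatCols_blockCols]
    exact (submatrix_mul_equiv X J id e.symm e.symm).symm
  let T := reindex e e Q * (Sᴴ * H)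
  have hTS : T * S = 1 := by
    rw [Matrix.mul_assoc, hgram, hQQ]
  refine ⟨a, g, fun j => (r j).k, fun j => (c j).l, fun j => (r j).lr, fun j => (c j).lc,
    fun j => (r j).η, e, S, T, fun j => (c j).im_pos, fun j => (r j).η_eq,
    mul_eq_one_symm hTS, hTS, ?_, ?_⟩
  · rw [Matrix.mul_assoc, hAS, ← Matrix.mul_assoc, hTS, Matrix.one_mul]
    refine congrArg (fun M => reindex e e (blockDiagonal' M)) (funext ?_)
    rintro (j | j) <;> rfl
  · rw [hgram]
    refine congrArg (fun M => reindex e e (blockDiagonal' M)) (funext ?_)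
    rintro (j | j) <;> rfl

end
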